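/- arXiv:1310.7984 — 2 statements merged into one kernel-verified Lean document; each statement's English description precedes it below -/
import Mathlib

section
/- Let G be the 3-cycle on vertices {1,2,3}, G* its whisker graph, and I = I(G*) ⊆ S* = K[x_1,x_2,x_3,y_1,y_2,y_3]. Then depth(S*/I) = 3 and depth(S*/I^k) = 0 for all k ≥ 2. -/
open MvPolynomial

/-- The depth of the module `M` with respect to the ideal `m`: the supremum of the
lengths of `M`-regular sequences consisting of elements of `m`. -/
noncomputable def idealDepth {R : Type*} [CommRing R] (m : Ideal R)
    (M : Type*) [AddCommGroup M] [Module R M] : ℕ :=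
  sSup {d : ℕ | ∃ rs : List R, rs.length = d ∧ (∀ r ∈ rs, r ∈ m) ∧
    RingTheory.Sequence.IsRegular M rs}

/-- The graded maximal ideal of a polynomial ring, generated by all the variables. -/
noncomputable def maxIdeal (σ K : Type*) [Field K] : Ideal (MvPolynomial σ K) :=
  Ideal.span (Set.range X)

/-- The edge ideal of the whisker graph `G*` of a graph `G` on `{1,…,n}`, inside
`S* = K[x_1,…,x_n,y_1,…,y_n]`, where `x_i = X (Sum.inl i)` and `y_i = X (Sum.inr i)`.
It is generated by `x_i x_j` for edges `{i,j}` of `G` and by `x_i y_i` for all `i`. -/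
noncomputable def whiskerEdgeIdeal {n : ℕ} (K : Type*) [Field K] (G : SimpleGraph (Fin n)) :
    Ideal (MvPolynomial (Fin n ⊕ Fin n) K) :=
  Ideal.span ({p | ∃ i j, G.Adj i j ∧ p = X (Sum.inl i) * X (Sum.inl j)} ∪
    Set.range (fun i : Fin n => X (Sum.inl i) * X (Sum.inr i)))


/-- A regular sequence on a finite module over a Noetherian ring is no longer than the
dimension of the support of the module. -/
theorem length_le_supportDim_of_isRegular {R : Type*} [CommRing R] [IsNoetherianRing R]
    {M : Type*} [AddCommGroup M] [Module R M] [Module.Finite R M] (rs : List R)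
    (reg : RingTheory.Sequence.IsRegular M rs) :
    (rs.length : WithBot ℕ∞) ≤ Module.supportDim R M := by
  induction rs generalizing M with
  | nil =>
    have := reg.nontrivial
    have := (Module.nonempty_support_of_nontrivial (R := R) (M := M)).to_subtype
    simpa [Module.supportDim] using Order.krullDim_nonneg (α := Module.support R M)
  | cons x rs ih =>
    obtain ⟨hx, hrs⟩ := (RingTheory.Sequence.isRegular_cons_iff M x rs).1 reg
    refine le_trans ?_ (Module.supportDim_quotSMulTop_succ_le_of_notMem_minimalPrimes
      fun _ ↦ hx.notMem_of_mem_minimalPrimes)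
    push_cast [List.length_cons]
    gcongr
    exact ih hrs

section Depth

variable {R : Type*} [CommRing R] {M : Type*} [AddCommGroup M] [Module R M]

/-- An ideal that annihilates a nonzero element of a module has depth zero on it. -/
theorem idealDepth_eq_zero_of_smul_eq_zero {m : Ideal R} {u : M} (hu : u ≠ 0)
    (h : ∀ r ∈ m, r • u = 0) : idealDepth m M = 0 := by
  refine Nat.eq_zero_of_le_zero (csSup_le' ?_)
  rintro d ⟨rs, rfl, hm, reg⟩
  cases rs with
  | nil => simp
  | cons x rs =>
    have hx := ((RingTheory.Sequence.isRegular_cons_iff M x rs).1 reg).1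
    exact absurd (hx.right_eq_zero_of_smul (h x (hm x (by simp)))) hu

theorem idealDepth_eq_of_isRegular {m : Ideal R} {rs : List R} (hm : ∀ r ∈ rs, r ∈ m)
    (reg : RingTheory.Sequence.IsRegular M rs)
    (hle : ∀ rs' : List R, RingTheory.Sequence.IsRegular M rs' → rs'.length ≤ rs.length) :
    idealDepth m M = rs.length := by
  refine IsGreatest.csSup_eq ⟨⟨rs, rfl, hm, reg⟩, ?_⟩
  rintro d ⟨rs', rfl, -, reg'⟩
  exact hle rs' reg'

end Depth

theorem ringKrullDim_le_of_isIntegral (A B : Type*) [CommRing A] [CommRing B] [Algebra A B]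
    [Algebra.IsIntegral A B] : ringKrullDim B ≤ ringKrullDim A :=
  Order.krullDim_le_of_strictMono (PrimeSpectrum.comap (algebraMap A B)) fun _ _ hpq ↦
    Ideal.IsIntegral.comap_lt_comap hpq

/-- The variables of a polynomial ring form a regular sequence. -/
theorem MvPolynomial.isRegular_ofFn_X (K : Type*) [Field K] (n : ℕ) :
    RingTheory.Sequence.IsRegular (MvPolynomial (Fin n) K)
      (List.ofFn (X (R := K) (σ := Fin n))) := by
  refine ⟨⟨fun i hi ↦ ?_⟩, ?_⟩
  · have hin : i < n := by simpa using hi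
    have hspan : Ideal.ofList ((List.ofFn (X (R := K) (σ := Fin n))).take i) =
        Ideal.span (X '' {j : Fin n | (j : ℕ) < i}) := by
      refine congrArg Ideal.span (Set.ext fun p ↦ ?_)
      simp only [Set.mem_ofPred_eq, List.mem_take_iff_getElem, Set.mem_image, List.length_ofFn,
        List.getElem_ofFn, lt_min_iff]
      exact ⟨fun ⟨j, hj, hp⟩ ↦ ⟨⟨j, hj.2⟩, hj.1, hp⟩, fun ⟨j, hj, hp⟩ ↦ ⟨j, ⟨hj, j.2⟩, hp⟩⟩
    rw [isSMulRegular_quotient_iff_mem_of_smul_mem, hspan]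
    intro f hf
    simp only [smul_eq_mul, Ideal.mul_top, List.getElem_ofFn, mem_ideal_span_X_image] at hf ⊢
    intro s hs
    obtain ⟨j, hj, hne⟩ := hf (Finsupp.single ⟨i, hin⟩ 1 + s) (by simpa using hs)
    have hji : (⟨i, hin⟩ : Fin n) ≠ j := fun h ↦ by simp [← h] at hj
    exact ⟨j, hj, by simpa [Finsupp.single_apply, hji] using hne⟩
  · have hle : Ideal.ofList (List.ofFn (X (R := K) (σ := Fin n))) ≤
        RingHom.ker (constantCoeff (R := K) (σ := Fin n)) := by
      refine Ideal.span_le.2 fun p hp ↦ ?_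
      obtain ⟨j, rfl⟩ := (List.mem_ofFn' _ _).1 hp
      simp
    intro h
    rw [smul_eq_mul, Ideal.mul_top] at h
    have : (1 : MvPolynomial (Fin n) K) ∈ RingHom.ker (constantCoeff (R := K) (σ := Fin n)) :=
      hle (h ▸ Submodule.mem_top)
    simp at this

section WhiskerComplete

variable (K : Type*) [Field K] (n : ℕ)

/-- The coordinate ring of the whisker graph of the complete graph on `n` vertices. -/
abbrev WhiskerRing : Type _ :=
  MvPolynomial (Fin n ⊕ Fin n) K ⧸ whiskerEdgeIdeal K (⊤ : SimpleGraph (Fin n))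

/-- The `K`-algebra map sending the `i`-th variable to `x_i + y_i`. -/
noncomputable def whiskerParam : MvPolynomial (Fin n) K →ₐ[K] WhiskerRing K n :=
  aeval fun i ↦ Ideal.Quotient.mk _ (X (Sum.inl i) + X (Sum.inr i))

noncomputable instance WhiskerRing.algebra : Algebra (MvPolynomial (Fin n) K) (WhiskerRing K n) :=
  (whiskerParam K n).toRingHom.toAlgebra

noncomputable instance WhiskerRing.module : Module (MvPolynomial (Fin n) K) (WhiskerRing K n) :=
  Algebra.toModule

theorem WhiskerRing.algebraMap_eq (a : MvPolynomial (Fin n) K) :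
    algebraMap (MvPolynomial (Fin n) K) (WhiskerRing K n) a = whiskerParam K n a :=
  rfl

/-- The restriction to the component of the whisker ring on which all `x_j` vanish except
possibly the one singled out by `o`, parametrized by the functions `x_j + y_j`. -/
noncomputable def whiskerComponent (o : Option (Fin n)) :
    WhiskerRing K n →ₐ[K] MvPolynomial (Fin n) K :=
  Ideal.Quotient.liftₐ _
    (aeval (Sum.elim (fun j ↦ if o = some j then X j else 0)
      fun j ↦ if o = some j then 0 else X j)) <| by
    suffices h : whiskerEdgeIdeal K (⊤ : SimpleGraph (Fin n)) ≤ RingHom.ker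
        (aeval (R := K) (Sum.elim (fun j ↦ if o = some j then (X j : MvPolynomial (Fin n) K) else 0)
          fun j ↦ if o = some j then 0 else X j)) from fun a ha ↦
      RingHom.mem_ker.1 (h ha)
    refine Ideal.span_le.2 ?_
    rintro p (⟨i, j, hij, rfl⟩ | ⟨i, rfl⟩)
    · have hne : i ≠ j := hij
      simp only [SetLike.mem_coe, RingHom.mem_ker, map_mul, aeval_X, Sum.elim_inl]
      grind
    · simp only [SetLike.mem_coe, RingHom.mem_ker, map_mul, aeval_X, Sum.elim_inl, Sum.elim_inr]
      grind

theorem whiskerComponent_mk (o : Option (Fin n)) (p : MvPolynomial (Fin n ⊕ Fin n) K) :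
    whiskerComponent K n o (Ideal.Quotient.mk _ p) =
      aeval (Sum.elim (fun j ↦ if o = some j then X j else 0)
        fun j ↦ if o = some j then 0 else X j) p :=
  rfl

/-- The family `1, x_1, …, x_n` of elements of the whisker ring. -/
noncomputable def whiskerGenerator : Option (Fin n) → WhiskerRing K n
  | none => 1
  | some i => Ideal.Quotient.mk _ (X (Sum.inl i))

theorem whiskerComponent_whiskerParam (o : Option (Fin n)) (a : MvPolynomial (Fin n) K) :
    whiskerComponent K n o (whiskerParam K n a) = a := by
  suffices h : (whiskerComponent K n o).comp (whiskerParam K n) = AlgHom.id K _ from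
    DFunLike.congr_fun h a
  ext1 i
  simp only [whiskerParam, AlgHom.comp_apply, aeval_X, AlgHom.id_apply, whiskerComponent_mk,
    map_add, Sum.elim_inl, Sum.elim_inr]
  split <;> simp

theorem whiskerComponent_mk_X_inl (o : Option (Fin n)) (j : Fin n) :
    whiskerComponent K n o (Ideal.Quotient.mk _ (X (Sum.inl j))) =
      if o = some j then X j else 0 := by
  simp [whiskerComponent_mk]

theorem whiskerRing_mk_X_inl_mul_X_inl {i j : Fin n} (h : i ≠ j) :
    (Ideal.Quotient.mk _ (X (Sum.inl i)) * Ideal.Quotient.mk _ (X (Sum.inl j)) :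
      WhiskerRing K n) = 0 := by
  rw [← map_mul, Ideal.Quotient.eq_zero_iff_mem]
  exact Ideal.subset_span (.inl ⟨i, j, h, rfl⟩)

theorem whiskerRing_mk_X_inl_mul_X_inr (i : Fin n) :
    (Ideal.Quotient.mk _ (X (Sum.inl i)) * Ideal.Quotient.mk _ (X (Sum.inr i)) :
      WhiskerRing K n) = 0 := by
  rw [← map_mul, Ideal.Quotient.eq_zero_iff_mem]
  exact Ideal.subset_span (.inr ⟨i, rfl⟩)

theorem linearIndependent_whiskerGenerator :
    LinearIndependent (MvPolynomial (Fin n) K) (whiskerGenerator K n) := by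
  rw [Fintype.linearIndependent_iff]
  intro g hg
  have key (o : Option (Fin n)) :
      g none + ∑ j, g (some j) * (if o = some j then X j else 0) = 0 := by
    have := congrArg (whiskerComponent K n o) hg
    simpa only [Fintype.sum_option, Algebra.smul_def, WhiskerRing.algebraMap_eq, map_add,
      map_mul, map_sum, whiskerGenerator, map_one,
      mul_one, map_zero, whiskerComponent_whiskerParam, whiskerComponent_mk_X_inl] using this
  have h0 : g none = 0 := by simpa using key none
  rintro (_ | i)
  · exact h0
  · simpa [h0] using key (some i)

theorem span_whiskerGenerator :
    Submodule.span (MvPolynomial (Fin n) K) (Set.range (whiskerGenerator K n)) = ⊤ := by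
  set N := Submodule.span (MvPolynomial (Fin n) K) (Set.range (whiskerGenerator K n))
  have hX (i : Fin n) (b : WhiskerRing K n) : (X i : MvPolynomial (Fin n) K) • b =
      (Ideal.Quotient.mk _ (X (Sum.inl i)) + Ideal.Quotient.mk _ (X (Sum.inr i))) * b := by
    simp [Algebra.smul_def, WhiskerRing.algebraMap_eq, whiskerParam]
  have hgen (o) : whiskerGenerator K n o ∈ N := Submodule.subset_span ⟨o, rfl⟩
  have hinl (i : Fin n) (b : WhiskerRing K n) (hb : b ∈ N) :
      b * Ideal.Quotient.mk _ (X (Sum.inl i)) ∈ N := by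
    induction hb using Submodule.span_induction with
    | mem b hb =>
      obtain ⟨(_ | j), rfl⟩ := hb
      · simpa [whiskerGenerator] using hgen (some i)
      · rcases eq_or_ne j i with rfl | hji
        · convert N.smul_mem (X j) (hgen (some j)) using 1
          rw [hX, whiskerGenerator]
          linear_combination -whiskerRing_mk_X_inl_mul_X_inr K n j
        · rw [whiskerGenerator, whiskerRing_mk_X_inl_mul_X_inl K n hji]
          exact N.zero_mem
    | zero => simp
    | add b c _ _ hb hc => rw [add_mul]; exact N.add_mem hb hc
    | smul a b _ hb => rw [smul_mul_assoc]; exact N.smul_mem a hb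
  rw [eq_top_iff]
  rintro b -
  obtain ⟨p, rfl⟩ := Ideal.Quotient.mk_surjective b
  induction p using MvPolynomial.induction_on with
  | C a =>
    convert N.smul_mem (C a) (hgen none) using 1
    simp only [Algebra.smul_def, WhiskerRing.algebraMap_eq, whiskerGenerator, whiskerParam,
      mul_one, algHom_C]
    rfl
  | add p q hp hq => rw [map_add]; exact N.add_mem hp hq
  | mul_X p i hp =>
    rw [map_mul]
    rcases i with i | i
    · exact hinl i _ hp
    · convert N.sub_mem (N.smul_mem (X i) hp) (hinl i _ hp) using 1
      rw [hX]
      ring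

/-- The whisker ring of a complete graph is free over the polynomial ring in the `x_i + y_i`,
with basis `1, x_1, …, x_n`. -/
noncomputable def whiskerBasis :
    Module.Basis (Option (Fin n)) (MvPolynomial (Fin n) K) (WhiskerRing K n) :=
  .mk (linearIndependent_whiskerGenerator K n) (span_whiskerGenerator K n).ge

theorem ringKrullDim_whiskerRing_le : ringKrullDim (WhiskerRing K n) ≤ n := by
  have := Module.Finite.of_basis (whiskerBasis K n)
  refine (ringKrullDim_le_of_isIntegral (MvPolynomial (Fin n) K) (WhiskerRing K n)).trans ?_
  simp

theorem isRegular_whiskerRing :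
    RingTheory.Sequence.IsRegular (WhiskerRing K n)
      (List.ofFn fun i : Fin n ↦
        (X (Sum.inl i) + X (Sum.inr i) : MvPolynomial (Fin n ⊕ Fin n) K)) := by
  have := Module.Free.of_basis (whiskerBasis K n)
  have : Nontrivial (WhiskerRing K n) :=
    (whiskerComponent K n none).toRingHom.domain_nontrivial
  have reg : RingTheory.Sequence.IsRegular (WhiskerRing K n) _ :=
    (isRegular_ofFn_X K n).of_faithfullyFlat
  refine (AddEquiv.isRegular_congr (e := AddEquiv.refl _) ?_).2 reg
  rw [List.map_ofFn, List.forall₂_iff_get]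
  refine ⟨by simp, fun i _ _ x ↦ ?_⟩
  simp only [List.get_eq_getElem, List.getElem_ofFn, Function.comp_apply, AddEquiv.refl_apply,
    WhiskerRing.algebraMap_eq, whiskerParam, aeval_X, smul_eq_mul]
  exact Algebra.smul_def _ x

theorem idealDepth_whiskerRing :
    idealDepth (maxIdeal (Fin n ⊕ Fin n) K) (WhiskerRing K n) = n := by
  have hX (i : Fin n ⊕ Fin n) : X i ∈ maxIdeal (Fin n ⊕ Fin n) K := Ideal.subset_span ⟨i, rfl⟩
  convert idealDepth_eq_of_isRegular (m := maxIdeal (Fin n ⊕ Fin n) K) ?_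
    (isRegular_whiskerRing K n) fun rs reg ↦ ?_
  · simp
  · intro r hr
    obtain ⟨i, rfl⟩ := (List.mem_ofFn' _ _).1 hr
    exact add_mem (hX _) (hX _)
  · have h := length_le_supportDim_of_isRegular rs reg
    rw [Module.supportDim_quotient_eq_ringKrullDim] at h
    simpa using h.trans (ringKrullDim_whiskerRing_le K n)

end WhiskerComplete

theorem whiskerEdgeIdeal_le_maxIdeal_sq {n : ℕ} (K : Type*) [Field K] (G : SimpleGraph (Fin n)) :
    whiskerEdgeIdeal K G ≤ maxIdeal (Fin n ⊕ Fin n) K ^ 2 := by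
  have hX (i : Fin n ⊕ Fin n) : X i ∈ maxIdeal (Fin n ⊕ Fin n) K := Ideal.subset_span ⟨i, rfl⟩
  rw [sq]
  refine Ideal.span_le.2 ?_
  rintro p (⟨i, j, -, rfl⟩ | ⟨i, rfl⟩)
  · exact Ideal.mul_mem_mul (hX _) (hX _)
  · exact Ideal.mul_mem_mul (hX _) (hX _)

/-- A nonzero form of degree less than `k` does not lie in the `k`-th power of the
graded maximal ideal. -/
theorem MvPolynomial.IsHomogeneous.notMem_maxIdeal_pow {σ K : Type*} [Field K]
    {p : MvPolynomial σ K} {d k : ℕ} (hp : p.IsHomogeneous d) (hne : p ≠ 0) (hdk : d < k) :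
    p ∉ maxIdeal σ K ^ k := by
  intro h
  obtain ⟨s, hs⟩ := support_nonempty.2 hne
  have hks := (mem_pow_idealOfVars_iff k p).1 h s hs
  have hds : s.degree = d := by
    by_contra hds
    exact mem_support_iff.1 hs (hp.coeff_eq_zero hds)
  omega

/-- The product of the vertices of the triangle multiplies the graded maximal ideal into the
square of the edge ideal. -/
theorem mul_triangle_mem_whiskerEdgeIdeal_sq (K : Type*) [Field K]
    {r : MvPolynomial (Fin 3 ⊕ Fin 3) K} (hr : r ∈ maxIdeal (Fin 3 ⊕ Fin 3) K) :
    r * (X (Sum.inl 0) * X (Sum.inl 1) * X (Sum.inl 2)) ∈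
      whiskerEdgeIdeal K (⊤ : SimpleGraph (Fin 3)) ^ 2 := by
  set I := whiskerEdgeIdeal K (⊤ : SimpleGraph (Fin 3))
  have hxx (i j : Fin 3) (h : i ≠ j) : X (Sum.inl i) * X (Sum.inl j) ∈ I :=
    Ideal.subset_span (.inl ⟨i, j, h, rfl⟩)
  have hxy (i : Fin 3) : X (Sum.inl i) * X (Sum.inr i) ∈ I := Ideal.subset_span (.inr ⟨i, rfl⟩)
  have key (i j l : Fin 3) (hij : i ≠ j) (hil : i ≠ l) (hjl : j ≠ l) :
      X (Sum.inl i) * (X (Sum.inl i) * X (Sum.inl j) * X (Sum.inl l)) ∈ I ^ 2 ∧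
      X (Sum.inr i) * (X (Sum.inl i) * X (Sum.inl j) * X (Sum.inl l)) ∈ I ^ 2 := by
    rw [sq]
    constructor
    · convert Ideal.mul_mem_mul (hxx i j hij) (hxx i l hil) using 1
      ring
    · convert Ideal.mul_mem_mul (hxy i) (hxx j l hjl) using 1
      ring
  have h0 := key 0 1 2 (by decide) (by decide) (by decide)
  have h1 := key 1 0 2 (by decide) (by decide) (by decide)
  have h2 := key 2 0 1 (by decide) (by decide) (by decide)
  rw [mul_comm (X (Sum.inl 1)) (X (Sum.inl 0))] at h1
  rw [mul_assoc (X (Sum.inl 2)), mul_comm (X (Sum.inl 2)) (X (Sum.inl 0) * X (Sum.inl 1))] at h2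
  induction hr using Submodule.span_induction with
  | mem r hr =>
    obtain ⟨i | i, rfl⟩ := hr
    · fin_cases i
      exacts [h0.1, h1.1, h2.1]
    · fin_cases i
      exacts [h0.2, h1.2, h2.2]
  | zero => simp
  | add a b _ _ ha hb => rw [add_mul]; exact add_mem ha hb
  | smul a b _ hb => rw [smul_mul_assoc]; exact Submodule.smul_mem _ a hb

/-- For the 3-cycle `G` (the complete graph on three vertices) one has `depth(S*/I(G*)) = 3`
and `depth(S*/I(G*)^k) = 0` for all `k ≥ 2`. -/
theorem depth_whisker_triangle (K : Type*) [Field K] :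
    idealDepth (maxIdeal (Fin 3 ⊕ Fin 3) K)
      (MvPolynomial (Fin 3 ⊕ Fin 3) K ⧸ (whiskerEdgeIdeal K (⊤ : SimpleGraph (Fin 3)))) = 3 ∧
    ∀ k : ℕ, 2 ≤ k →
      idealDepth (maxIdeal (Fin 3 ⊕ Fin 3) K)
        (MvPolynomial (Fin 3 ⊕ Fin 3) K ⧸
          (whiskerEdgeIdeal K (⊤ : SimpleGraph (Fin 3))) ^ k) = 0 := by
  refine ⟨idealDepth_whiskerRing K 3, fun k hk ↦ ?_⟩
  obtain ⟨k, rfl⟩ := Nat.exists_eq_add_of_le hk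
  let u : MvPolynomial (Fin 3 ⊕ Fin 3) K :=
    X (Sum.inl 0) * X (Sum.inl 1) * X (Sum.inl 2) * (X (Sum.inl 0) * X (Sum.inl 1)) ^ k
  refine idealDepth_eq_zero_of_smul_eq_zero (u := Ideal.Quotient.mk _ u) ?_ fun r hr ↦ ?_
  · rw [Ne, Ideal.Quotient.eq_zero_iff_mem]
    intro hu
    have hhom : u.IsHomogeneous (1 + 1 + 1 + (1 + 1) * k) :=
      (((isHomogeneous_X _ _).mul (isHomogeneous_X _ _)).mul (isHomogeneous_X _ _)).mul
        (((isHomogeneous_X _ _).mul (isHomogeneous_X _ _)).pow k)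
    have hne : u ≠ 0 := by simp [u, X_ne_zero]
    refine hhom.notMem_maxIdeal_pow hne (k := 2 * (2 + k)) (by omega) ?_
    rw [pow_mul]
    exact Ideal.pow_right_mono (whiskerEdgeIdeal_le_maxIdeal_sq K _) _ hu
  · change Ideal.Quotient.mk _ (r * u) = 0
    rw [Ideal.Quotient.eq_zero_iff_mem, pow_add, ← mul_assoc]
    refine Ideal.mul_mem_mul (mul_triangle_mem_whiskerEdgeIdeal_sq K hr)
      (Ideal.pow_mem_pow (Ideal.subset_span (.inl ⟨0, 1, ?_, rfl⟩)) k)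
    simp
end

section
/- Let G be a forest on n vertices with whisker graph G* and edge ideal I(G*) ⊆ S* = K[x_1,...,x_n,y_1,...,y_n]. Then depth(S*/I(G*)^2) ≥ n − 1. -/
open MvPolynomial

open RingTheory.Sequence

/-! ### Weakly regular sequences and extensions -/

theorem isWeaklyRegular_of_exact {R : Type*} [CommRing R] {M₁ M₂ M₃ : Type*}
    [AddCommGroup M₁] [Module R M₁] [AddCommGroup M₂] [Module R M₂] [AddCommGroup M₃] [Module R M₃]
    {f : M₁ →ₗ[R] M₂} {g : M₂ →ₗ[R] M₃} (hf : Function.Injective f) (hfg : Function.Exact f g)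
    (hg : Function.Surjective g) {rs : List R} (h₁ : IsWeaklyRegular M₁ rs)
    (h₃ : IsWeaklyRegular M₃ rs) : IsWeaklyRegular M₂ rs := by
  induction rs generalizing M₁ M₂ M₃ with
  | nil => exact .nil R M₂
  | cons r rs ih =>
    rw [isWeaklyRegular_cons_iff] at h₁ h₃ ⊢
    refine ⟨isSMulRegular_of_range_eq_ker hf hfg.linearMap_ker_eq.symm h₁.1 h₃.1,
      ih (f := QuotSMulTop.map r f) (g := QuotSMulTop.map r g) ?_ (QuotSMulTop.map_exact r hfg hg)
        (QuotSMulTop.map_surjective r hg) h₁.2 h₃.2⟩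
    have := QuotSMulTop.map_first_exact_on_four_term_exact_of_isSMulRegular_last
      ((LinearMap.exact_zero_iff_injective M₁ f).mpr hf) hfg h₃.1
    rw [map_zero] at this
    exact (LinearMap.exact_zero_iff_injective _ _).mp this

theorem isWeaklyRegular_quotient_of_colon {R : Type*} [CommRing R] {J C Q : Ideal R} (g : R)
    (hC : ∀ p, p ∈ C ↔ g * p ∈ J) (hQ : Q = J ⊔ Ideal.span {g}) {rs : List R}
    (h₁ : IsWeaklyRegular (R ⧸ C) rs) (h₃ : IsWeaklyRegular (R ⧸ Q) rs) :
    IsWeaklyRegular (R ⧸ J) rs := by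
  have hJQ : J ≤ Q := hQ ▸ le_sup_left
  have hCJ : C ≤ Submodule.comap (LinearMap.mulLeft R g) J := fun p hp => (hC p).mp hp
  refine isWeaklyRegular_of_exact (f := Submodule.mapQ C J (LinearMap.mulLeft R g) hCJ)
    (g := Submodule.mapQ J Q LinearMap.id hJQ) ?_ ?_ ?_ h₁ h₃
  · rw [← LinearMap.ker_eq_bot, Submodule.ker_mapQ, eq_bot_iff, Submodule.map_le_iff_le_comap,
      Submodule.comap_bot, Submodule.ker_mkQ]
    exact fun p hp => (hC p).mpr hp
  · intro y
    obtain ⟨p, rfl⟩ := Submodule.mkQ_surjective _ y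
    simp only [Submodule.mkQ_apply, Submodule.mapQ_apply, LinearMap.id_apply,
      Submodule.Quotient.mk_eq_zero, hQ]
    constructor
    · intro hp
      obtain ⟨a, ha, b, hb, rfl⟩ := Submodule.mem_sup.mp hp
      obtain ⟨c, rfl⟩ := Ideal.mem_span_singleton'.mp hb
      refine ⟨Submodule.Quotient.mk c, ?_⟩
      rw [Submodule.mapQ_apply, Submodule.Quotient.eq, LinearMap.mulLeft_apply]
      rw [show g * c - (a + c * g) = -a by ring]
      exact neg_mem ha
    · rintro ⟨z, hz⟩
      obtain ⟨c, rfl⟩ := Submodule.mkQ_surjective _ z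
      rw [Submodule.mkQ_apply, Submodule.mapQ_apply, Submodule.Quotient.eq,
        LinearMap.mulLeft_apply] at hz
      rw [show p = -(g * c - p) + c * g by ring]
      exact Submodule.add_mem_sup (neg_mem hz) (Ideal.mul_mem_left _ _
        (Ideal.mem_span_singleton_self g))
  · intro y
    obtain ⟨p, rfl⟩ := Submodule.mkQ_surjective _ y
    exact ⟨Submodule.Quotient.mk p, rfl⟩

theorem supportDim_add_length_le_of_isWeaklyRegular {R : Type*} [CommRing R] [IsNoetherianRing R]
    {M : Type*} [AddCommGroup M] [Module R M] [Module.Finite R M] {rs : List R}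
    (h : IsWeaklyRegular M rs) :
    Module.supportDim R (M ⧸ (Ideal.ofList rs • ⊤ : Submodule R M)) + rs.length ≤
      Module.supportDim R M := by
  induction rs generalizing M with
  | nil =>
    simpa using Module.supportDim_le_of_surjective _ (Submodule.mkQ_surjective _)
  | cons r rs ih =>
    rw [isWeaklyRegular_cons_iff] at h
    have h₁ := Module.supportDim_quotSMulTop_succ_le_of_notMem_minimalPrimes (R := R) (M := M)
      (x := r) fun _ => h.1.notMem_of_mem_minimalPrimes
    have h₂ := ih h.2
    rw [Module.supportDim_eq_of_equiv
      (Submodule.quotOfListConsSMulTopEquivQuotSMulTopInner M r rs), List.length_cons,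
      Nat.cast_add, Nat.cast_one, ← add_assoc]
    exact (add_le_add_left h₂ 1).trans h₁

theorem le_idealDepth {n : ℕ} {σ K : Type*} [Field K] [Finite σ] {m : Ideal (MvPolynomial σ K)}
    {M : Type*} [AddCommGroup M] [Module (MvPolynomial σ K) M] [Module.Finite (MvPolynomial σ K) M]
    {rs : List (MvPolynomial σ K)} (hn : rs.length = n) (hm : ∀ r ∈ rs, r ∈ m)
    (h : IsRegular M rs) : n ≤ idealDepth m M := by
  refine le_csSup ⟨Nat.card σ, ?_⟩ ⟨rs, hn, hm, h⟩
  rintro _ ⟨ts, rfl, -, ht⟩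
  have hdim := (supportDim_add_length_le_of_isWeaklyRegular ht.toIsWeaklyRegular).trans
    (Module.supportDim_le_ringKrullDim _ _)
  rw [MvPolynomial.ringKrullDim_of_isNoetherianRing, ringKrullDim_eq_zero_of_field, zero_add]
    at hdim
  have : Nontrivial (M ⧸ (Ideal.ofList ts • ⊤ : Submodule (MvPolynomial σ K) M)) :=
    Submodule.Quotient.nontrivial_iff.mpr ht.top_ne_smul.symm
  have h₀ : 0 ≤ Module.supportDim (MvPolynomial σ K)
      (M ⧸ (Ideal.ofList ts • ⊤ : Submodule (MvPolynomial σ K) M)) := by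
    have := Module.supportDim_ne_bot_of_nontrivial (MvPolynomial σ K)
      (M ⧸ (Ideal.ofList ts • ⊤ : Submodule (MvPolynomial σ K) M))
    exact Order.krullDim_nonneg_iff.mpr (Order.krullDim_ne_bot_iff.mp this)
  have := (add_le_add_left h₀ (ts.length : WithBot ℕ∞)).trans hdim
  rw [zero_add] at this
  exact_mod_cast this

/-! ### Linear forms -/

/-- The linear form `∑ vᵢ Xᵢ` with coefficient vector `v`. -/
noncomputable def linearForm (σ K : Type*) [Field K] : (σ →₀ K) →ₗ[K] MvPolynomial σ K :=
  Finsupp.linearCombination K X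

theorem linearForm_single {σ K : Type*} [Field K] (i : σ) :
    linearForm σ K (Finsupp.single i 1) = X i := by
  simp [linearForm]

theorem linearForm_injective (σ K : Type*) [Field K] : Function.Injective (linearForm σ K) :=
  MvPolynomial.linearIndependent_X σ K

theorem linearForm_mem_span {σ K : Type*} [Field K] {s : Set (σ →₀ K)} {v : σ →₀ K}
    (hv : v ∈ Submodule.span K s) : linearForm σ K v ∈ Ideal.span (linearForm σ K '' s) := by
  have := Submodule.mem_map_of_mem (f := linearForm σ K) hv
  rw [Submodule.map_span] at this
  exact Submodule.span_le_restrictScalars K (MvPolynomial σ K) _ this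

theorem mem_span_linearForm_of_mul_mem {σ K : Type*} [Field K] {s : Set (σ →₀ K)} {v : σ →₀ K}
    (hv : v ∉ Submodule.span K s) {p : MvPolynomial σ K}
    (hp : linearForm σ K v * p ∈ Ideal.span (linearForm σ K '' s)) :
    p ∈ Ideal.span (linearForm σ K '' s) := by
  obtain ⟨W, hW⟩ := (Submodule.span K s).exists_isCompl
  let π : (σ →₀ K) →ₗ[K] (σ →₀ K) := W.projection _ hW.symm
  have hπ : ∀ w, π w = 0 ↔ w ∈ Submodule.span K s := by
    intro w
    simp [π]
  have hsub : ∀ w, w - π w ∈ Submodule.span K s := Submodule.sub_projection_mem hW.symm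
  let φ : MvPolynomial σ K →ₐ[K] MvPolynomial σ K :=
    aeval fun i => linearForm σ K (π (Finsupp.single i 1))
  have hφ : ∀ w, φ (linearForm σ K w) = linearForm σ K (π w) := by
    intro w
    have : φ.toLinearMap ∘ₗ linearForm σ K = linearForm σ K ∘ₗ π := by
      ext i : 2
      simp [φ, linearForm_single]
    exact congrArg (· w) this
  have hker : ∀ q ∈ Ideal.span (linearForm σ K '' s), φ q = 0 := by
    intro q hq
    have : Ideal.span (linearForm σ K '' s) ≤ RingHom.ker φ := by
      rw [Ideal.span_le]
      rintro _ ⟨w, hw, rfl⟩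
      simp [hφ, (hπ w).mpr (Submodule.subset_span hw)]
    exact this hq
  have hmod : ∀ q, q - φ q ∈ Ideal.span (linearForm σ K '' s) := by
    intro q
    have : (Ideal.Quotient.mkₐ K (Ideal.span (linearForm σ K '' s))).comp φ =
        Ideal.Quotient.mkₐ K _ := by
      refine MvPolynomial.algHom_ext fun i => ?_
      have h := linearForm_mem_span (hsub (Finsupp.single i 1))
      rw [map_sub, linearForm_single] at h
      simpa [φ] using (Ideal.Quotient.eq.mpr h).symm
    exact Ideal.Quotient.eq.mp (congrArg (· q) this).symm
  have h₁ := hker _ hp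
  rw [map_mul, mul_eq_zero, hφ, map_eq_zero_iff _ (linearForm_injective σ K), hπ] at h₁
  simpa [h₁.resolve_left hv] using hmod p

theorem isWeaklyRegular_quotient_span_linearForm {σ K : Type*} [Field K] (s : Set (σ →₀ K))
    (l : List (σ →₀ K))
    (h : ∀ i (hi : i < l.length), l[i] ∉ Submodule.span K (s ∪ {v | v ∈ l.take i})) :
    IsWeaklyRegular (MvPolynomial σ K ⧸ Ideal.span (linearForm σ K '' s))
      (l.map (linearForm σ K)) := by
  refine ⟨fun i hi => ?_⟩
  rw [isSMulRegular_quotient_iff_mem_of_smul_mem]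
  have key : ∀ p : MvPolynomial σ K,
      (Submodule.Quotient.mk p : MvPolynomial σ K ⧸ Ideal.span (linearForm σ K '' s)) ∈
        (Ideal.ofList ((l.map (linearForm σ K)).take i) • ⊤ :
          Submodule (MvPolynomial σ K) (MvPolynomial σ K ⧸ Ideal.span (linearForm σ K '' s))) ↔
      p ∈ Ideal.span (linearForm σ K '' (s ∪ {v | v ∈ l.take i})) := by
    intro p
    have h₁ : (⊤ : Submodule (MvPolynomial σ K)
        (MvPolynomial σ K ⧸ Ideal.span (linearForm σ K '' s))) =
        Submodule.map (Submodule.mkQ _) ⊤ := by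
      rw [Submodule.map_top, Submodule.range_mkQ]
    have h₂ : Ideal.ofList ((l.map (linearForm σ K)).take i) =
        Ideal.span (linearForm σ K '' {v | v ∈ l.take i}) := by
      rw [Ideal.ofList, ← List.map_take]
      congr 1
      ext q
      simp only [Set.mem_image, Set.mem_ofPred_eq, List.mem_map]
    rw [h₁, ← Submodule.map_smul'', ← Submodule.mkQ_apply, ← Submodule.mem_comap,
      Submodule.comap_map_mkQ, Set.image_union, Ideal.span_union, h₂, smul_eq_mul, Ideal.mul_top]
  intro x hx
  obtain ⟨p, rfl⟩ := Submodule.mkQ_surjective _ x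
  rw [List.length_map] at hi
  rw [Submodule.mkQ_apply, ← Submodule.Quotient.mk_smul, key, smul_eq_mul, List.getElem_map] at hx
  rw [Submodule.mkQ_apply, key]
  exact mem_span_linearForm_of_mul_mem (h i hi) hx

/-! ### Monomial ideals -/

/-- The sequence `rs` is weakly regular on the quotient of the polynomial ring by the monomial
ideal whose monomials have their exponents in `U`. -/
def IsWeaklyRegularModMonomials {σ K : Type*} [Field K] (rs : List (MvPolynomial σ K))
    (U : Set (σ →₀ ℕ)) : Prop :=
  ∃ hU : IsUpperSet U, IsWeaklyRegular (MvPolynomial σ K ⧸ restrictSupportIdeal K U hU) rs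

theorem mem_restrictSupportIdeal {σ K : Type*} [Field K] {U : Set (σ →₀ ℕ)} {hU : IsUpperSet U}
    {p : MvPolynomial σ K} : p ∈ restrictSupportIdeal K U hU ↔ ∀ m ∈ p.support, m ∈ U :=
  Iff.rfl

theorem IsWeaklyRegularModMonomials.of_colon {σ K : Type*} [Field K]
    {rs : List (MvPolynomial σ K)} {U : Set (σ →₀ ℕ)} (hU : IsUpperSet U) (g : σ →₀ ℕ)
    (hC : IsWeaklyRegularModMonomials rs {m | g + m ∈ U})
    (hQ : IsWeaklyRegularModMonomials rs (U ∪ {m | g ≤ m})) :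
    IsWeaklyRegularModMonomials rs U := by
  obtain ⟨hCU, hC⟩ := hC
  obtain ⟨hQU, hQ⟩ := hQ
  refine ⟨hU, isWeaklyRegular_quotient_of_colon (monomial g 1) ?_ ?_ hC hQ⟩
  · intro p
    simp only [mem_restrictSupportIdeal, mem_support_iff, Set.mem_ofPred_eq]
    constructor
    · intro h m hm
      rw [coeff_monomial_mul'] at hm
      split_ifs at hm with hgm
      · have := h (m - g) (by simpa using hm)
        rwa [add_tsub_cancel_of_le hgm] at this
      · exact absurd rfl hm
    · intro h m hm
      exact h (g + m) (by simpa [coeff_monomial_mul] using hm)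
  · apply le_antisymm
    · intro p hp
      rw [← support_sum_monomial_coeff p]
      refine sum_mem fun m hm => ?_
      rcases hp hm with hm | hm
      · refine Ideal.mem_sup_left (mem_restrictSupportIdeal.mpr fun m' hm' => ?_)
        rwa [Finset.mem_singleton.mp (support_monomial_subset hm')]
      · refine Ideal.mem_sup_right (Ideal.mem_span_singleton.mpr ⟨monomial (m - g) (p.coeff m), ?_⟩)
        rw [monomial_mul, one_mul, add_tsub_cancel_of_le hm]
    · refine sup_le (fun p hp m hm => Or.inl (hp hm)) ?_
      rw [Ideal.span_le, Set.singleton_subset_iff]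
      refine mem_restrictSupportIdeal.mpr fun m hm => Or.inr ?_
      rw [Finset.mem_singleton.mp (support_monomial_subset hm)]
      exact le_refl g

/-- Exponents of the monomials divisible by a variable in `Z`. -/
def variableExponents {σ : Type*} (Z : Set σ) : Set (σ →₀ ℕ) :=
  {m | ∃ z ∈ Z, m z ≠ 0}

theorem isUpperSet_variableExponents {σ : Type*} (Z : Set σ) :
    IsUpperSet (variableExponents Z) := by
  rintro m m' hm ⟨z, hz, h⟩
  have := hm z
  exact ⟨z, hz, by omega⟩

theorem IsWeaklyRegularModMonomials.variableExponents {σ K : Type*} [Field K] (Z : Set σ)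
    (l : List (σ →₀ K))
    (h : ∀ i (hi : i < l.length), ∃ ψ : (σ →₀ K) →ₗ[K] K, (∀ z ∈ Z, ψ (Finsupp.single z 1) = 0) ∧
      (∀ v ∈ l.take i, ψ v = 0) ∧ ψ l[i] ≠ 0) :
    IsWeaklyRegularModMonomials (l.map (linearForm σ K)) (_root_.variableExponents Z) := by
  refine ⟨isUpperSet_variableExponents Z, ?_⟩
  have hI : restrictSupportIdeal K (_root_.variableExponents Z) (isUpperSet_variableExponents Z) =
      Ideal.span (linearForm σ K '' ((fun z => Finsupp.single z 1) '' Z)) := by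
    ext p
    simp only [Set.image_image, linearForm_single]
    rw [mem_ideal_span_X_image]
    rfl
  rw [hI]
  refine isWeaklyRegular_quotient_span_linearForm _ l fun i hi hmem => ?_
  obtain ⟨ψ, hZ, hl, hψ⟩ := h i hi
  have hle : Submodule.span K (((fun z => Finsupp.single z 1) '' Z) ∪ {v | v ∈ l.take i}) ≤
      LinearMap.ker ψ := by
    rw [Submodule.span_le]
    rintro _ (⟨z, hz, rfl⟩ | hv)
    · exact hZ z hz
    · exact hl _ hv
  exact hψ (hle hmem)

/-! ### Exponents of edge ideals and their squares -/

section EdgeIdeals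

variable {σ : Type*}

/-- Exponents of the monomials in the edge ideal of `H`. -/
def edgeExponents (H : SimpleGraph σ) : Set (σ →₀ ℕ) :=
  {m | ∃ a b, H.Adj a b ∧ m a ≠ 0 ∧ m b ≠ 0}

/-- Exponents of the monomials in the square of the edge ideal of `H`. -/
def edgeSquareExponents (H : SimpleGraph σ) : Set (σ →₀ ℕ) :=
  {m | ∃ a b c d, H.Adj a b ∧ H.Adj c d ∧ Finsupp.single a 1 + Finsupp.single b 1 +
    (Finsupp.single c 1 + Finsupp.single d 1) ≤ m}

theorem isUpperSet_edgeExponents (H : SimpleGraph σ) : IsUpperSet (edgeExponents H) := by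
  rintro m m' hm ⟨a, b, hab, ha, hb⟩
  have := hm a
  have := hm b
  exact ⟨a, b, hab, by omega, by omega⟩

theorem isUpperSet_edgeSquareExponents (H : SimpleGraph σ) :
    IsUpperSet (edgeSquareExponents H) := by
  rintro m m' hm ⟨a, b, c, d, hab, hcd, h⟩
  exact ⟨a, b, c, d, hab, hcd, h.trans hm⟩

theorem single_add_single_le_iff {a b : σ} (hab : a ≠ b) {m : σ →₀ ℕ} :
    Finsupp.single a 1 + Finsupp.single b 1 ≤ m ↔ m a ≠ 0 ∧ m b ≠ 0 := by
  classical
  constructor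
  · intro h
    have h₁ := h a
    have h₂ := h b
    simp only [Finsupp.add_apply, Finsupp.single_apply] at h₁ h₂
    grind
  · rintro ⟨h₁, h₂⟩ z
    simp only [Finsupp.add_apply, Finsupp.single_apply]
    grind

theorem edgeSquareExponents_subset (H : SimpleGraph σ) :
    edgeSquareExponents H ⊆ edgeExponents H := by
  rintro m ⟨a, b, c, d, hab, -, h⟩
  exact ⟨a, b, hab, (single_add_single_le_iff hab.ne).mp (le_self_add.trans h)⟩

theorem mem_edgeSquareExponents_of_add {H : SimpleGraph σ} {u v : σ} (huv : H.Adj u v)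
    {m : σ →₀ ℕ} (hm : m ∈ edgeExponents H) :
    Finsupp.single u 1 + Finsupp.single v 1 + m ∈ edgeSquareExponents H := by
  obtain ⟨c, d, hcd, h⟩ := hm
  exact ⟨u, v, c, d, huv, hcd, add_le_add_right ((single_add_single_le_iff hcd.ne).mpr h) _⟩

/-- The colon of `I(H)² + I(F)` by an edge `uv` of `H` such that all other edges at `v` lie
in `F`. -/
theorem colon_edgeSquareExponents_union {H F : SimpleGraph σ} (hFH : F ≤ H) {u v : σ}
    (huv : H.Adj u v) (huvF : ¬ F.Adj u v) (hv : ∀ w, H.Adj v w → w ≠ u → F.Adj v w) :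
    {m | Finsupp.single u 1 + Finsupp.single v 1 + m ∈
      edgeSquareExponents H ∪ edgeExponents F} =
    edgeExponents H ∪ variableExponents {z | F.Adj u z ∨ F.Adj v z} := by
  classical
  ext m
  have hne := huv.ne
  have hF : Finsupp.single u 1 + Finsupp.single v 1 + m ∈ edgeExponents F →
      m ∈ edgeExponents H ∪ variableExponents {z | F.Adj u z ∨ F.Adj v z} := by
    rintro ⟨a, b, hab, ha, hb⟩
    simp only [Finsupp.add_apply, Finsupp.single_apply] at ha hb
    have hvuF : ¬ F.Adj v u := fun h => huvF h.symm
    by_cases hau : a = u ∨ a = v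
    · exact Or.inr ⟨b, by grind, by grind [F.irrefl]⟩
    · by_cases hbu : b = u ∨ b = v
      · exact Or.inr ⟨a, by grind [hab.symm], by grind⟩
      · exact Or.inl ⟨a, b, hFH hab, by grind, by grind⟩
  constructor
  · rintro (⟨a, b, c, d, hab, hcd, h⟩ | h)
    · by_cases habF : F.Adj a b
      · exact hF ⟨a, b, habF, (single_add_single_le_iff hab.ne).mp (le_self_add.trans h)⟩
      by_cases hcdF : F.Adj c d
      · exact hF ⟨c, d, hcdF, (single_add_single_le_iff hcd.ne).mp (le_add_self.trans h)⟩
      have hend : ∀ x y, H.Adj x y → ¬ F.Adj x y →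
          (x ≠ v ∧ y ≠ v) ∨ (x = u ∧ y = v) ∨ (x = v ∧ y = u) := by
        intro x y hxy hxyF
        have := hv x
        have := hv y
        grind [hxy.symm, F.adj_comm x y]
      have key : ∀ z, _ := fun z => h z
      simp only [Finsupp.add_apply, Finsupp.single_apply] at key
      have ha := key a
      have hb := key b
      have hc := key c
      have hd := key d
      have hab' := hab.ne
      have hcd' := hcd.ne
      left
      have h₁ := hend a b hab habF
      have h₂ := hend c d hcd hcdF
      suffices (m a ≠ 0 ∧ m b ≠ 0) ∨ (m c ≠ 0 ∧ m d ≠ 0) by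
        rcases this with h | h
        · exact ⟨a, b, hab, h⟩
        · exact ⟨c, d, hcd, h⟩
      clear key h hend hF hv huvF habF hcdF
      grind
    · exact hF h
  · rintro (h | ⟨z, hz, h⟩)
    · exact Or.inl (mem_edgeSquareExponents_of_add huv h)
    · right
      rcases hz with hz | hz
      · exact ⟨u, z, hz, by simp, by simp [h]⟩
      · exact ⟨v, z, hz, by simp, by simp [h]⟩

theorem edgeExponents_union_edge {F F' : SimpleGraph σ} {u v : σ} (huv : u ≠ v)
    (hF' : ∀ a b, F'.Adj a b ↔ F.Adj a b ∨ (a = u ∧ b = v) ∨ (a = v ∧ b = u)) :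
    edgeExponents F ∪ {m | Finsupp.single u 1 + Finsupp.single v 1 ≤ m} = edgeExponents F' := by
  ext m
  simp only [Set.mem_union, Set.mem_ofPred_eq, edgeExponents, single_add_single_le_iff huv, hF']
  constructor
  · rintro (⟨a, b, h⟩ | h)
    · exact ⟨a, b, Or.inl h.1, h.2⟩
    · exact ⟨u, v, by simp, h⟩
  · rintro ⟨a, b, h | ⟨rfl, rfl⟩ | ⟨rfl, rfl⟩, h'⟩
    · exact Or.inl ⟨a, b, h, h'⟩
    · exact Or.inr h'
    · exact Or.inr h'.symm

theorem isWeaklyRegularModMonomials_edgeSquare_step {K : Type*} [Field K]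
    {rs : List (MvPolynomial σ K)} {H F F' : SimpleGraph σ} (hFH : F ≤ H) {u v : σ}
    (huv : H.Adj u v) (huvF : ¬ F.Adj u v) (hv : ∀ w, H.Adj v w → w ≠ u → F.Adj v w)
    (hF' : ∀ a b, F'.Adj a b ↔ F.Adj a b ∨ (a = u ∧ b = v) ∨ (a = v ∧ b = u))
    (hC : IsWeaklyRegularModMonomials rs
      (edgeExponents H ∪ variableExponents {z | F.Adj u z ∨ F.Adj v z}))
    (hQ : IsWeaklyRegularModMonomials rs (edgeSquareExponents H ∪ edgeExponents F')) :
    IsWeaklyRegularModMonomials rs (edgeSquareExponents H ∪ edgeExponents F) := by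
  refine .of_colon ((isUpperSet_edgeSquareExponents H).union (isUpperSet_edgeExponents F))
    (Finsupp.single u 1 + Finsupp.single v 1) ?_ ?_
  · rwa [colon_edgeSquareExponents_union hFH huv huvF hv]
  · rwa [Set.union_assoc, edgeExponents_union_edge huv.ne hF']

theorem isWeaklyRegularModMonomials_edge_variable_step {K : Type*} [Field K]
    {rs : List (MvPolynomial σ K)} {H : SimpleGraph σ} {Z : Set σ} {u : σ} (hu : u ∉ Z)
    (hC : IsWeaklyRegularModMonomials rs
      (edgeExponents H ∪ variableExponents (Z ∪ {z | H.Adj u z})))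
    (hQ : IsWeaklyRegularModMonomials rs (edgeExponents H ∪ variableExponents (insert u Z))) :
    IsWeaklyRegularModMonomials rs (edgeExponents H ∪ variableExponents Z) := by
  classical
  refine .of_colon ((isUpperSet_edgeExponents H).union (isUpperSet_variableExponents Z))
    (Finsupp.single u 1) ?_ ?_
  · convert hC using 1
    ext m
    constructor
    · rintro (⟨a, b, hab, ha, hb⟩ | ⟨z, hz, h⟩)
      · simp only [Finsupp.add_apply, Finsupp.single_apply] at ha hb
        by_cases hau : u = a
        · subst hau
          exact Or.inr ⟨b, Or.inr hab, by grind [hab.ne]⟩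
        · by_cases hbu : u = b
          · subst hbu
            exact Or.inr ⟨a, Or.inr hab.symm, by grind⟩
          · exact Or.inl ⟨a, b, hab, by grind, by grind⟩
      · have : u ≠ z := by
          rintro rfl
          exact hu hz
        exact Or.inr ⟨z, Or.inl hz, by simpa [Finsupp.single_apply, this] using h⟩
    · rintro (⟨a, b, hab, ha, hb⟩ | ⟨z, hz | hz, h⟩)
      · exact Or.inl ⟨a, b, hab, by simp [ha], by simp [hb]⟩
      · exact Or.inr ⟨z, hz, by simp [h]⟩
      · exact Or.inl ⟨u, z, hz, by simp, by simp [h]⟩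
  · convert hQ using 1
    rw [Set.union_assoc]
    congr 1
    ext m
    simp only [Set.mem_union, variableExponents, Set.mem_ofPred_eq, Finsupp.single_le_iff,
      Nat.one_le_iff_ne_zero, Set.mem_insert_iff, exists_eq_or_imp]
    exact or_comm

end EdgeIdeals

/-! ### Whisker graphs -/

/-- The graph `D` with a whisker attached to every vertex in `T`. -/
def whiskerGraph {V : Type*} (D : SimpleGraph V) (T : Set V) : SimpleGraph (V ⊕ V) where
  Adj
    | .inl i, .inl j => D.Adj i j
    | .inl i, .inr j => i = j ∧ i ∈ T
    | .inr i, .inl j => i = j ∧ i ∈ T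
    | .inr _, .inr _ => False
  symm := ⟨by
    rintro (i | i) (j | j) h
    · exact SimpleGraph.Adj.symm (G := D) h
    · exact ⟨h.1.symm, h.1 ▸ h.2⟩
    · exact ⟨h.1.symm, h.1 ▸ h.2⟩
    · exact h⟩
  loopless := ⟨by
    rintro (i | i) h
    · exact D.irrefl h
    · exact h⟩

section whiskerGraph

variable {V : Type*} {D : SimpleGraph V} {T : Set V} {i j : V}

@[simp]
theorem whiskerGraph_adj_inl_inl : (whiskerGraph D T).Adj (.inl i) (.inl j) ↔ D.Adj i j :=
  Iff.rfl

@[simp]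
theorem whiskerGraph_adj_inl_inr : (whiskerGraph D T).Adj (.inl i) (.inr j) ↔ i = j ∧ i ∈ T :=
  Iff.rfl

@[simp]
theorem whiskerGraph_adj_inr_inl : (whiskerGraph D T).Adj (.inr i) (.inl j) ↔ i = j ∧ i ∈ T :=
  Iff.rfl

@[simp]
theorem whiskerGraph_not_adj_inr_inr : ¬ (whiskerGraph D T).Adj (.inr i) (.inr j) :=
  id

theorem whiskerGraph_mono {D' : SimpleGraph V} {T' : Set V} (hD : D ≤ D') (hT : T ⊆ T') :
    whiskerGraph D T ≤ whiskerGraph D' T' := by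
  rintro (i | i) (j | j) h
  · exact hD h
  · exact ⟨h.1, hT h.2⟩
  · exact ⟨h.1, hT h.2⟩
  · exact h

end whiskerGraph

/-- The coefficient vector of the linear form `xᵢ - yᵢ`. -/
noncomputable def whiskerVector (K : Type*) [Field K] {n : ℕ} (i : Fin n) : Fin n ⊕ Fin n →₀ K :=
  Finsupp.single (.inl i) 1 - Finsupp.single (.inr i) 1

/-- The sequence of linear forms `(xᵢ - yᵢ) - (x₀ - y₀)` with `i ≠ 0`. -/
noncomputable def whiskerSequence (K : Type*) [Field K] (n : ℕ) :
    List (MvPolynomial (Fin (n + 1) ⊕ Fin (n + 1)) K) :=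
  (List.ofFn fun i : Fin n => whiskerVector K i.succ - whiskerVector K 0).map (linearForm _ K)

section Regularity

variable {K : Type*} [Field K] {n : ℕ}

theorem exists_functional_whiskerVector (Z : Set (Fin n ⊕ Fin n)) (t : Fin n → K)
    (ht : ∀ i, .inl i ∈ Z → .inr i ∈ Z → t i = 0) :
    ∃ ψ : (Fin n ⊕ Fin n →₀ K) →ₗ[K] K, (∀ z ∈ Z, ψ (Finsupp.single z 1) = 0) ∧
      ∀ i, ψ (whiskerVector K i) = t i := by
  classical
  refine ⟨Finsupp.linearCombination K (Sum.elim (fun i => if .inl i ∈ Z then 0 else t i)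
    fun i => if .inr i ∈ Z then 0 else if .inl i ∈ Z then -t i else 0), ?_, ?_⟩
  · rintro (i | i) hz <;> simp [hz]
  · intro i
    have := ht i
    simp only [whiskerVector, map_sub, Finsupp.linearCombination_single, one_smul, Sum.elim_inl,
      Sum.elim_inr]
    split_ifs <;> simp_all

theorem whiskerSequence_variableExponents (Z : Set (Fin (n + 1) ⊕ Fin (n + 1)))
    (hfull : ∀ i j, .inl i ∈ Z → .inr i ∈ Z → .inl j ∈ Z → .inr j ∈ Z → i = j) :
    IsWeaklyRegularModMonomials (whiskerSequence K n) (variableExponents Z) := by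
  classical
  refine .variableExponents Z _ fun k hk => ?_
  rw [List.length_ofFn] at hk
  have hex : ∀ q : Fin (n + 1), 0 ≠ q → ∃ t : Fin (n + 1) → K,
      (∀ i, .inl i ∈ Z → .inr i ∈ Z → t i = 0) ∧ t q ≠ t 0 ∧ ∀ j, j ≠ q → t j = t 0 := by
    intro q hq
    by_cases h : Sum.inl q ∈ Z ∧ Sum.inr q ∈ Z
    · refine ⟨fun i => if i = q then 0 else 1, fun i hi hi' => ?_, by simp [hq], fun j hj => ?_⟩
      · simp [hfull i q hi hi' h.1 h.2]
      · simp [hj, hq]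
    · refine ⟨fun i => if i = q then 1 else 0, fun i hi hi' => if_neg ?_, by simp [hq],
        fun j hj => by simp [hj, hq]⟩
      rintro rfl
      exact h ⟨hi, hi'⟩
  obtain ⟨t, ht, htk, htj⟩ := hex (Fin.succ ⟨k, hk⟩) (Fin.succ_ne_zero _).symm
  obtain ⟨ψ, hψZ, hψ⟩ := exists_functional_whiskerVector Z t ht
  refine ⟨ψ, hψZ, ?_, ?_⟩
  · intro v hv
    obtain ⟨j, hj, rfl⟩ := List.mem_take_iff_getElem.mp hv
    simp only [List.getElem_ofFn, map_sub, hψ, sub_eq_zero]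
    refine htj _ fun h => ?_
    have := congrArg Fin.val h
    simp only [Fin.val_succ] at this
    omega
  · simpa [hψ, sub_eq_zero] using htk

theorem whiskerSequence_edge_variable (G : SimpleGraph (Fin (n + 1)))
    (Z : Set (Fin (n + 1) ⊕ Fin (n + 1)))
    (hfull : ∀ i j, .inl i ∈ Z → .inr i ∈ Z → .inl j ∈ Z → .inr j ∈ Z → i = j)
    (hnbr : ∀ i, .inr i ∈ Z → .inl i ∈ Z ∨ ∀ j, G.Adj i j → .inl j ∈ Z) :
    IsWeaklyRegularModMonomials (whiskerSequence K n)
      (edgeExponents (whiskerGraph G Set.univ) ∪ variableExponents Z) := by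
  induction hc : {i | Sum.inl i ∉ Z ∧ Sum.inr i ∉ Z}.ncard using Nat.strong_induction_on
    generalizing Z with
  | _ c ih =>
    by_cases hex : ∃ i, Sum.inl i ∉ Z ∧ Sum.inr i ∉ Z
    · obtain ⟨i, hi, hi'⟩ := hex
      have hlt : ∀ Z', Z ⊆ Z' → (Sum.inl i ∈ Z' ∨ Sum.inr i ∈ Z') →
          {i | Sum.inl i ∉ Z' ∧ Sum.inr i ∉ Z'}.ncard < c := by
        intro Z' hZ h
        rw [← hc]
        refine Set.ncard_lt_ncard (Set.ssubset_iff_exists.mpr ⟨?_, i, ⟨hi, hi'⟩, ?_⟩)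
        · exact fun j hj => ⟨fun h => hj.1 (hZ h), fun h => hj.2 (hZ h)⟩
        · exact fun hj => h.elim hj.1 hj.2
      refine isWeaklyRegularModMonomials_edge_variable_step hi (ih _ (hlt _ ?_ ?_) _ ?_ ?_ rfl)
        (ih _ (hlt _ ?_ ?_) _ ?_ ?_ rfl)
      · exact Set.subset_union_left
      · right; right; simp
      · simp only [Set.mem_union, Set.mem_ofPred_eq, whiskerGraph_adj_inl_inl,
          whiskerGraph_adj_inl_inr, Set.mem_univ, and_true]
        have : ∀ j, Sum.inr j ∈ Z → G.Adj i j → Sum.inl j ∈ Z := by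
          intro j hj hij
          exact (hnbr j hj).resolve_right fun h => hi (h i hij.symm)
        grind [G.irrefl]
      · simp only [Set.mem_union, Set.mem_ofPred_eq, whiskerGraph_adj_inl_inl,
          whiskerGraph_adj_inl_inr, Set.mem_univ, and_true]
        grind
      · exact Set.subset_insert _ _
      · left; simp
      · simp only [Set.mem_insert_iff, Sum.inl.injEq, reduceCtorEq, false_or]
        grind
      · simp only [Set.mem_insert_iff, Sum.inl.injEq, reduceCtorEq, false_or]
        grind
    · push Not at hex
      rw [Set.union_eq_self_of_subset_left]
      · exact whiskerSequence_variableExponents Z hfull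
      · rintro m ⟨a | a, b | b, hab, ha, hb⟩
        · by_cases haZ : Sum.inl a ∈ Z
          · exact ⟨_, haZ, ha⟩
          · exact ⟨_, (hnbr a (hex a haZ)).resolve_left haZ b hab, hb⟩
        · obtain ⟨rfl, -⟩ := hab
          by_cases haZ : Sum.inl a ∈ Z
          · exact ⟨_, haZ, ha⟩
          · exact ⟨_, hex a haZ, hb⟩
        · obtain ⟨rfl, -⟩ := hab
          by_cases haZ : Sum.inl a ∈ Z
          · exact ⟨_, haZ, hb⟩
          · exact ⟨_, hex a haZ, ha⟩
        · exact hab.elim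

theorem whiskerSequence_edge (G : SimpleGraph (Fin (n + 1))) :
    IsWeaklyRegularModMonomials (whiskerSequence K n)
      (edgeExponents (whiskerGraph G Set.univ)) := by
  have h : variableExponents (∅ : Set (Fin (n + 1) ⊕ Fin (n + 1))) = ∅ := by
    ext m
    simp [variableExponents]
  simpa [h] using whiskerSequence_edge_variable (K := K) G ∅ (by simp) (by simp)

theorem exists_unique_neighbor_of_isAcyclic {V : Type*} [Finite V] {G : SimpleGraph V}
    (hG : G.IsAcyclic) {a b : V} (hab : G.Adj a b) :
    ∃ u v, G.Adj u v ∧ ∀ w, G.Adj v w → w = u := by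
  have : Nonempty V := ⟨a⟩
  obtain ⟨u, v, p, hp, hmax⟩ := SimpleGraph.Walk.exists_isPath_forall_isPath_length_le_length G
  have hnil : ¬ p.Nil := by
    intro h
    have := hmax _ _ _ (SimpleGraph.Walk.IsPath.of_adj hab)
    simp [SimpleGraph.Walk.length_eq_zero_iff.mpr h] at this
  refine ⟨_, u, (p.adj_snd hnil).symm, fun w hadj => ?_⟩
  apply hG.eq_snd_of_adj_start hp hadj
  have : ¬ (p.cons hadj.symm).IsPath := by grind [SimpleGraph.Walk.length_cons]
  grind [hp.cons]

theorem whiskerSequence_edgeSquare_union_of_isAcyclic_sdiff (G D : SimpleGraph (Fin (n + 1)))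
    (hD : D ≤ G) (hG : (G \ D).IsAcyclic) :
    IsWeaklyRegularModMonomials (whiskerSequence K n)
      (edgeSquareExponents (whiskerGraph G Set.univ) ∪
        edgeExponents (whiskerGraph D Set.univ)) := by
  induction hc : (G \ D).edgeSet.ncard using Nat.strong_induction_on generalizing D with
  | _ c ih =>
    by_cases hex : ∃ a b, (G \ D).Adj a b
    · obtain ⟨a, b, hab⟩ := hex
      obtain ⟨i, j, hij, hj⟩ := exists_unique_neighbor_of_isAcyclic hG hab
      simp only [SimpleGraph.sdiff_adj] at hij hj
      have hne := hij.1.ne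
      have hDi : ¬ D.Adj j i := fun h => hij.2 h.symm
      have hDj : ∀ w, G.Adj j w → w ≠ i → D.Adj j w := fun w h hw => by
        by_contra h'
        exact hw (hj w ⟨h, h'⟩)
      have hD' : ∀ a b, (D ⊔ SimpleGraph.edge i j).Adj a b ↔
          D.Adj a b ∨ (a = i ∧ b = j) ∨ (a = j ∧ b = i) := by
        intro a b
        simp only [SimpleGraph.sup_adj, SimpleGraph.edge_adj]
        grind
      have hle : D ⊔ SimpleGraph.edge i j ≤ G := by
        intro a b h
        rcases (hD' a b).mp h with h | ⟨rfl, rfl⟩ | ⟨rfl, rfl⟩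
        exacts [hD h, hij.1, hij.1.symm]
      refine isWeaklyRegularModMonomials_edgeSquare_step (u := .inl i) (v := .inl j)
        (F' := whiskerGraph (D ⊔ SimpleGraph.edge i j) Set.univ)
        (whiskerGraph_mono hD le_rfl) hij.1 hij.2 ?_ ?_ ?_ (ih _ ?_ _ hle ?_ rfl)
      · rintro (w | w) hw hwi
        · exact hDj w hw fun h => hwi (h ▸ rfl)
        · exact hw
      · rintro (a | a) (b | b) <;> simp [hD']
      · refine isWeaklyRegularModMonomials_edge_variable_step (u := .inl i) ?_ ?_ ?_
        · simp [hDi]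
        · apply whiskerSequence_edge_variable
          all_goals
            simp only [Set.mem_union, Set.mem_ofPred_eq, whiskerGraph_adj_inl_inl,
              whiskerGraph_adj_inl_inr, Set.mem_univ, and_true]
            grind [G.irrefl, D.irrefl]
        · apply whiskerSequence_edge_variable
          all_goals
            simp only [Set.mem_insert_iff, Set.mem_ofPred_eq, whiskerGraph_adj_inl_inl,
              whiskerGraph_adj_inl_inr, Set.mem_univ, and_true, Sum.inl.injEq, reduceCtorEq,
              false_or]
            grind [G.irrefl, D.irrefl]
      · rw [← hc]
        refine Set.ncard_lt_ncard (Set.ssubset_iff_exists.mpr ⟨?_, s(i, j), ?_, ?_⟩)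
        · exact SimpleGraph.edgeSet_mono (sdiff_le_sdiff_left le_sup_left)
        · exact hij
        · simp [hne]
      · exact hG.anti (sdiff_le_sdiff_left le_sup_left)
    · have hGD : D = G := by
        refine le_antisymm hD fun a b hab => ?_
        by_contra h
        exact hex ⟨a, b, hab, h⟩
      rw [hGD, Set.union_eq_self_of_subset_left (edgeSquareExponents_subset _)]
      exact whiskerSequence_edge G

theorem whiskerSequence_edgeSquare_union_whiskers (G : SimpleGraph (Fin (n + 1)))
    (hG : G.IsAcyclic) (T : Set (Fin (n + 1))) :
    IsWeaklyRegularModMonomials (whiskerSequence K n)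
      (edgeSquareExponents (whiskerGraph G Set.univ) ∪ edgeExponents (whiskerGraph ⊥ T)) := by
  induction hc : Tᶜ.ncard using Nat.strong_induction_on generalizing T with
  | _ c ih =>
    by_cases hex : ∃ i, i ∉ T
    · obtain ⟨i, hi⟩ := hex
      refine isWeaklyRegularModMonomials_edgeSquare_step (u := .inl i) (v := .inr i)
        (F' := whiskerGraph ⊥ (insert i T))
        (whiskerGraph_mono bot_le (Set.subset_univ _)) ?_ ?_ ?_ ?_ ?_ (ih _ ?_ _ rfl)
      · simp
      · simp [hi]
      · rintro (w | w) hw hwi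
        · exact (hwi (hw.1 ▸ rfl)).elim
        · exact hw.elim
      · rintro (a | a) (b | b) <;> simp <;> grind
      · apply whiskerSequence_edge_variable
        all_goals
          simp only [Set.mem_ofPred_eq, whiskerGraph_adj_inl_inl, whiskerGraph_adj_inr_inl,
            whiskerGraph_adj_inl_inr, whiskerGraph_not_adj_inr_inr, SimpleGraph.bot_adj]
          grind
      · rw [← hc]
        refine Set.ncard_lt_ncard (compl_lt_compl_iff_lt.mpr (Set.ssubset_insert hi))
    · push Not at hex
      rw [Set.eq_univ_of_forall hex]
      exact whiskerSequence_edgeSquare_union_of_isAcyclic_sdiff G ⊥ bot_le (by simpa using hG)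

theorem whiskerSequence_edgeSquare (G : SimpleGraph (Fin (n + 1))) (hG : G.IsAcyclic) :
    IsWeaklyRegularModMonomials (whiskerSequence K n)
      (edgeSquareExponents (whiskerGraph G Set.univ)) := by
  have h : edgeExponents (whiskerGraph (⊥ : SimpleGraph (Fin (n + 1))) ∅) = ∅ := by
    rw [Set.eq_empty_iff_forall_notMem]
    rintro m ⟨a | a, b | b, hab, -⟩ <;> simp at hab
  simpa [h] using whiskerSequence_edgeSquare_union_whiskers (K := K) G hG ∅

theorem whiskerEdgeIdeal_eq_span_monomial (G : SimpleGraph (Fin n)) :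
    whiskerEdgeIdeal K G = Ideal.span ((fun s => monomial s (1 : K)) ''
      {s | ∃ a b, (whiskerGraph G Set.univ).Adj a b ∧
        s = Finsupp.single a 1 + Finsupp.single b 1}) := by
  have hX : ∀ a b : Fin n ⊕ Fin n, (X a * X b : MvPolynomial _ K) =
      monomial (Finsupp.single a 1 + Finsupp.single b 1) 1 := by
    intro a b
    rw [X, X, monomial_mul, one_mul]
  rw [whiskerEdgeIdeal]
  congr 1
  ext p
  constructor
  · rintro (⟨i, j, hij, rfl⟩ | ⟨i, rfl⟩)
    · exact ⟨_, ⟨.inl i, .inl j, hij, rfl⟩, (hX _ _).symm⟩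
    · exact ⟨_, ⟨.inl i, .inr i, by simp, rfl⟩, (hX _ _).symm⟩
  · rintro ⟨_, ⟨a | a, b | b, hab, rfl⟩, rfl⟩
    · exact Or.inl ⟨a, b, hab, (hX _ _).symm⟩
    · obtain ⟨rfl, -⟩ := hab
      exact Or.inr ⟨a, hX _ _⟩
    · obtain ⟨rfl, -⟩ := hab
      exact Or.inr ⟨a, by rw [add_comm]; exact hX _ _⟩
    · exact hab.elim

open scoped Pointwise in
theorem whiskerEdgeIdeal_sq_eq (G : SimpleGraph (Fin n)) :
    whiskerEdgeIdeal K G ^ 2 = restrictSupportIdeal K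
      (edgeSquareExponents (whiskerGraph G Set.univ)) (isUpperSet_edgeSquareExponents _) := by
  rw [whiskerEdgeIdeal_eq_span_monomial, sq, Ideal.span_mul_span']
  have : ∀ E : Set (Fin n ⊕ Fin n →₀ ℕ), (fun s => monomial s (1 : K)) '' E *
      (fun s => monomial s (1 : K)) '' E =
      (fun s => monomial s (1 : K)) '' Set.image2 (· + ·) E E := by
    intro E
    rw [← Set.image2_mul, Set.image2_image_left, Set.image2_image_right, Set.image_image2]
    simp only [monomial_mul, one_mul]
  rw [this]
  ext p
  rw [mem_ideal_span_monomial_image, mem_restrictSupportIdeal]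
  refine forall₂_congr fun m _ => ⟨?_, ?_⟩
  · rintro ⟨_, ⟨_, ⟨a, b, hab, rfl⟩, _, ⟨c, d, hcd, rfl⟩, rfl⟩, h⟩
    exact ⟨a, b, c, d, hab, hcd, h⟩
  · rintro ⟨a, b, c, d, hab, hcd, h⟩
    exact ⟨_, ⟨_, ⟨a, b, hab, rfl⟩, _, ⟨c, d, hcd, rfl⟩, rfl⟩, h⟩

end Regularity

theorem isRegular_quotient_of_isWeaklyRegular {R : Type*} [CommRing R] {J m : Ideal R}
    (hm : m ≠ ⊤) (hJ : J ≤ m) {rs : List R} (hrs : ∀ r ∈ rs, r ∈ m)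
    (h : IsWeaklyRegular (R ⧸ J) rs) : IsRegular (R ⧸ J) rs := by
  refine ⟨h, fun htop => hm ?_⟩
  have hle : Ideal.ofList rs ≤ m := Ideal.span_le.mpr hrs
  have h₁ : (⊤ : Submodule R (R ⧸ J)) = Submodule.map (Submodule.mkQ J) ⊤ := by
    rw [Submodule.map_top, Submodule.range_mkQ]
  rw [h₁, ← Submodule.map_smul'', smul_eq_mul, Ideal.mul_top] at htop
  have h₂ := congrArg (Submodule.comap (Submodule.mkQ J)) htop
  rw [Submodule.comap_map_mkQ, Submodule.comap_map_mkQ, sup_top_eq] at h₂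
  exact top_le_iff.mp (h₂ ▸ sup_le hJ hle)

theorem maxIdeal_ne_top (σ K : Type*) [Field K] : maxIdeal σ K ≠ ⊤ := by
  have : maxIdeal σ K ≤ RingHom.ker (constantCoeff (σ := σ) (R := K)) := by
    rw [maxIdeal, Ideal.span_le]
    rintro _ ⟨i, rfl⟩
    simp
  exact fun h => RingHom.ker_ne_top (constantCoeff (σ := σ) (R := K)) (top_le_iff.mp (h ▸ this))

theorem linearForm_mem_maxIdeal {σ K : Type*} [Field K] (v : σ →₀ K) :
    linearForm σ K v ∈ maxIdeal σ K := by
  rw [linearForm, Finsupp.linearCombination_apply, Finsupp.sum]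
  exact sum_mem fun i _ => Submodule.smul_of_tower_mem _ _ (Ideal.subset_span ⟨i, rfl⟩)

theorem whiskerEdgeIdeal_le_maxIdeal {n : ℕ} (K : Type*) [Field K] (G : SimpleGraph (Fin n)) :
    whiskerEdgeIdeal K G ≤ maxIdeal (Fin n ⊕ Fin n) K := by
  rw [whiskerEdgeIdeal, Ideal.span_le]
  rintro _ (⟨i, j, -, rfl⟩ | ⟨i, rfl⟩)
  all_goals exact Ideal.mul_mem_right _ _ (Ideal.subset_span ⟨_, rfl⟩)

/-- Villarreal: if `G` is a forest on `n` vertices, then `depth(S*/I(G*)^2) ≥ n - 1`. -/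
theorem depth_whisker_square_ge_of_forest {n : ℕ} (K : Type*) [Field K]
    (G : SimpleGraph (Fin n)) (hG : G.IsAcyclic) :
    n - 1 ≤ idealDepth (maxIdeal (Fin n ⊕ Fin n) K)
      (MvPolynomial (Fin n ⊕ Fin n) K ⧸ (whiskerEdgeIdeal K G) ^ 2) := by
  cases n with
  | zero => exact Nat.zero_le _
  | succ n =>
    have hmem : ∀ r ∈ whiskerSequence K n, r ∈ maxIdeal (Fin (n + 1) ⊕ Fin (n + 1)) K := by
      intro r hr
      obtain ⟨v, -, rfl⟩ := List.mem_map.mp hr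
      exact linearForm_mem_maxIdeal v
    refine le_idealDepth (rs := whiskerSequence K n) (by simp [whiskerSequence]) hmem
      (isRegular_quotient_of_isWeaklyRegular (maxIdeal_ne_top _ K) ?_ hmem ?_)
    · exact (Ideal.pow_le_self two_ne_zero).trans (whiskerEdgeIdeal_le_maxIdeal K G)
    · rw [whiskerEdgeIdeal_sq_eq]
      exact (whiskerSequence_edgeSquare G hG).2
end
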